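/- Let w, v ∈ W^P ∩ W^odd with w(1) = 1 and v(1) ≠ 1, and suppose v is the minimal length representative of w s_α W_P for some positive root α ∈ R^+ ∖ R_P^+. Then: (1) α = t_1 ± t_j for some k+1 ≤ j ≤ n+1, and the coefficient of the simple coroot α_k^∨ in the simple coroot expansion of α^∨ equals 1 (i.e. the corresponding edge of the moment graph has degree 1); (2) ℓ(v) > ℓ(w). -/

import Mathlib

/-!
Common framework: the Weyl group of type `C_{m+1}` realized as signed permutations
of `Fin (2*m+2)` (values 0-indexed: the paper's 1-indexed value `a ∈ {1, …, 2m+2}`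
corresponds to `a-1`, and the paper's `bar a = 2m+3-a` corresponds to `2m+2-a`).
For the odd symplectic Grassmannian `IG(k, 2n+1)` one takes `m = n`;
the smaller group `W_{2n}` of type `C_n` corresponds to `m = n-1`.
-/

namespace OddSymplectic

open Equiv

noncomputable section

/-- The element of `Fin (2*m+2)` with (0-indexed) value `i`. -/
def fn (m i : ℕ) : Fin (2*m+2) := ⟨i % (2*m+2), Nat.mod_lt _ (by omega)⟩

/-- The bar involution on values. -/
def bar (m : ℕ) (j : Fin (2*m+2)) : Fin (2*m+2) := ⟨2*m+1 - (j:ℕ), by omega⟩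

def barPerm (m : ℕ) : Equiv.Perm (Fin (2*m+2)) :=
  Function.Involutive.toPerm (bar m) (fun j => by
    have hj := j.isLt
    apply Fin.ext
    simp [bar]
    omega)

/-- The Weyl group of type `C_{m+1}`: the permutations of `Fin (2*m+2)` commuting with
the bar involution (signed permutations). -/
def Weyl (m : ℕ) : Subgroup (Equiv.Perm (Fin (2*m+2))) :=
  Subgroup.centralizer {barPerm m}

/-- The simple reflection `s_i`, `1 ≤ i ≤ m+1`. -/
def sRefl (m i : ℕ) : Equiv.Perm (Fin (2*m+2)) :=
  if i ≤ m then
    Equiv.swap (fn m (i-1)) (fn m i) * Equiv.swap (fn m (2*m+2-i)) (fn m (2*m+1-i))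
  else
    Equiv.swap (fn m m) (fn m (m+1))

/-- Coxeter length: the minimal length of an expression as a product of simple reflections. -/
def len (m : ℕ) (w : Equiv.Perm (Fin (2*m+2))) : ℕ :=
  sInf {r | ∃ l : List ℕ, l.length = r ∧ (∀ i ∈ l, 1 ≤ i ∧ i ≤ m+1) ∧
    (l.map (sRefl m)).prod = w}

/-- The set of reflections. -/
def reflections (m : ℕ) : Set (Equiv.Perm (Fin (2*m+2))) :=
  {t | ∃ u ∈ Weyl m, ∃ i, 1 ≤ i ∧ i ≤ m+1 ∧ t = u * sRefl m i * u⁻¹}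

/-- The Bruhat order. -/
def bruhatLE (m : ℕ) (u w : Equiv.Perm (Fin (2*m+2))) : Prop :=
  Relation.ReflTransGen (fun a b => ∃ t ∈ reflections m, b = a * t ∧ len m a < len m b) u w

/-- The parabolic subgroup `W_P` generated by the simple reflections `s_i`, `i ≠ kk`. -/
def WP (m kk : ℕ) : Subgroup (Equiv.Perm (Fin (2*m+2))) :=
  Subgroup.closure {x | ∃ i, 1 ≤ i ∧ i ≤ m+1 ∧ i ≠ kk ∧ x = sRefl m i}

/-- `x W_P = y W_P`. -/
def cosetEq (m kk : ℕ) (x y : Equiv.Perm (Fin (2*m+2))) : Prop := x⁻¹ * y ∈ WP m kk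

/-- `w ∈ W^P`: `w` is a minimal length representative of its coset `w W_P`. -/
def isMinRep (m kk : ℕ) (w : Equiv.Perm (Fin (2*m+2))) : Prop :=
  w ∈ Weyl m ∧ ∀ v ∈ WP m kk, len m w ≤ len m (w * v)

/-- `w ∈ W^{odd}`: `w(j) ≠ bar 1` for all `1 ≤ j ≤ m+1` (1-indexed positions). -/
def isOdd (m : ℕ) (w : Equiv.Perm (Fin (2*m+2))) : Prop :=
  ∀ j : Fin (2*m+2), (j:ℕ) ≤ m → w j ≠ fn m (2*m+1)

/-- `w ∈ W°`: odd symplectic permutations with `w(j) ≠ 1` for `1 ≤ j ≤ kk`. -/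
def isOpen (m kk : ℕ) (w : Equiv.Perm (Fin (2*m+2))) : Prop :=
  isOdd m w ∧ ∀ j : Fin (2*m+2), (j:ℕ) < kk → w j ≠ fn m 0

/-- `φ(u)`: the number of barred entries among the first `kk` values of `u`. -/
def phi (m kk : ℕ) (u : Equiv.Perm (Fin (2*m+2))) : ℕ :=
  (Finset.univ.filter (fun j : Fin (2*m+2) => (j:ℕ) < kk ∧ m+1 ≤ ((u j : ℕ)))).card

/-- The set of values of `w` on the first `kk` positions. -/
def valSet (m kk : ℕ) (w : Equiv.Perm (Fin (2*m+2))) : Finset (Fin (2*m+2)) :=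
  (Finset.univ.filter (fun j : Fin (2*m+2) => (j:ℕ) < kk)).image w

/-- The (1-indexed) absolute value `|x|` of a signed entry. -/
def absVal (m : ℕ) (x : Fin (2*m+2)) : ℕ :=
  if (x:ℕ) ≤ m then (x:ℕ)+1 else 2*m+2-(x:ℕ)

/-! ### Hecke products -/

def hStep (m : ℕ) (w : Equiv.Perm (Fin (2*m+2))) (i : ℕ) : Equiv.Perm (Fin (2*m+2)) :=
  if len m w < len m (w * sRefl m i) then w * sRefl m i else w

/-- Hecke product of `w` with the word `l` of simple reflections. -/
def hWord (m : ℕ) (w : Equiv.Perm (Fin (2*m+2))) (l : List ℕ) : Equiv.Perm (Fin (2*m+2)) :=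
  l.foldl (hStep m) w

def hStepK (m kk : ℕ) (w : Equiv.Perm (Fin (2*m+2))) (i : ℕ) : Equiv.Perm (Fin (2*m+2)) :=
  if len m w < len m (w * sRefl m i) ∨ i = kk then w * sRefl m i else w

/-- Modified Hecke product `·_k` of `w` with the word `l`. -/
def hWordK (m kk : ℕ) (w : Equiv.Perm (Fin (2*m+2))) (l : List ℕ) : Equiv.Perm (Fin (2*m+2)) :=
  l.foldl (hStepK m kk) w

/-- The list `[a, a+1, …, b]`. -/
def ascList (a b : ℕ) : List ℕ := List.range' a (b+1-a)

/-- The word `s_1 s_2 ⋯ s_{m+1} ⋯ s_2 s_1` for `O^∘(1)`. -/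
def wordOcirc1 (m : ℕ) : List ℕ := ascList 1 (m+1) ++ (ascList 1 m).reverse

/-- The word `s_1 ⋯ s_{kk-1} s_{kk+1} ⋯ s_{m+1} ⋯ s_2 s_1` for `O_Y(1)`. -/
def wordOY1 (m kk : ℕ) : List ℕ :=
  ascList 1 (kk-1) ++ ascList (kk+1) (m+1) ++ (ascList 1 m).reverse

/-- The word `s_2 ⋯ s_{m+1} ⋯ s_2` for `O_Z(1)`. -/
def wordOZ1 (m : ℕ) : List ℕ := ascList 2 (m+1) ++ (ascList 2 m).reverse

def wordOcirc (m d : ℕ) : List ℕ := (List.replicate d (wordOcirc1 m)).flatten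
def wordOZ (m d : ℕ) : List ℕ := (List.replicate d (wordOZ1 m)).flatten

/-- `w ·_k O^∘(d)`. -/
def mulOcirc (m kk : ℕ) (w : Equiv.Perm (Fin (2*m+2))) (d : ℕ) : Equiv.Perm (Fin (2*m+2)) :=
  hWordK m kk w (wordOcirc m d)

/-- `w · O_Z(d)`. -/
def mulOZ (m : ℕ) (w : Equiv.Perm (Fin (2*m+2))) (d : ℕ) : Equiv.Perm (Fin (2*m+2)) :=
  hWord m w (wordOZ m d)

/-- `w · O_Y(1)`. -/
def mulOY1 (m kk : ℕ) (w : Equiv.Perm (Fin (2*m+2))) : Equiv.Perm (Fin (2*m+2)) :=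
  hWord m w (wordOY1 m kk)

/-- `w · O_Y(d) = (w · O_Y(1)) ·_k O^∘(d-1)`. -/
def mulOY (m kk : ℕ) (w : Equiv.Perm (Fin (2*m+2))) (d : ℕ) : Equiv.Perm (Fin (2*m+2)) :=
  mulOcirc m kk (mulOY1 m kk w) (d-1)

/-! ### Positive roots of type `C_{m+1}` -/

/-- Positive roots of type `C_{m+1}` (1-indexed `i < j ≤ m+1`). -/
inductive PosRoot : Type
  | tm (i j : ℕ)   -- `t_i - t_j`
  | tp (i j : ℕ)   -- `t_i + t_j`
  | lg (i : ℕ)     -- `2 t_i`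

def PosRoot.valid (m : ℕ) : PosRoot → Prop
  | .tm i j => 1 ≤ i ∧ i < j ∧ j ≤ m+1
  | .tp i j => 1 ≤ i ∧ i < j ∧ j ≤ m+1
  | .lg i => 1 ≤ i ∧ i ≤ m+1

/-- The reflection `s_α`. -/
def PosRoot.refl (m : ℕ) : PosRoot → Equiv.Perm (Fin (2*m+2))
  | .tm i j => Equiv.swap (fn m (i-1)) (fn m (j-1)) *
      Equiv.swap (fn m (2*m+2-i)) (fn m (2*m+2-j))
  | .tp i j => Equiv.swap (fn m (i-1)) (fn m (2*m+2-j)) *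
      Equiv.swap (fn m (j-1)) (fn m (2*m+2-i))
  | .lg i => Equiv.swap (fn m (i-1)) (fn m (2*m+2-i))

/-- The coefficient of the simple root `α_kk` in the expansion of `α` in simple roots. -/
def PosRoot.rootCoeff (m kk : ℕ) : PosRoot → ℕ
  | .tm i j => if i ≤ kk ∧ kk < j then 1 else 0
  | .tp i j => if i ≤ kk ∧ kk < j then 1 else if j ≤ kk ∧ kk ≤ m then 2
      else if j ≤ kk then 1 else 0
  | .lg i => if i ≤ kk ∧ kk ≤ m then 2 else if i ≤ kk then 1 else 0

/-- The coefficient of the simple coroot `α_kk^∨` in the expansion of `α^∨` in simple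
coroots: the degree of the corresponding edge of the moment graph. -/
def PosRoot.corootCoeff (kk : ℕ) : PosRoot → ℕ
  | .tm i j => if i ≤ kk ∧ kk < j then 1 else 0
  | .tp i j => if i ≤ kk ∧ kk < j then 1 else if j ≤ kk then 2 else 0
  | .lg i => if i ≤ kk then 1 else 0

/-- `α ∈ R_1^+`. -/
def PosRoot.inR1 (m kk : ℕ) : PosRoot → Bool
  | .tm i j => decide (1 ≤ i ∧ i ≤ kk ∧ kk < j ∧ j ≤ m+1)
  | .tp i j => decide (1 ≤ i ∧ i ≤ kk ∧ kk < j ∧ j ≤ m+1)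
  | .lg i => decide (1 ≤ i ∧ i ≤ kk)

/-- `α ∈ R_2^+`. -/
def PosRoot.inR2 (kk : ℕ) : PosRoot → Bool
  | .tp i j => decide (1 ≤ i ∧ i < j ∧ j ≤ kk)
  | _ => false

/-- Chains in the moment graph of `IG(kk, 2m+2)`, recorded with their list of roots:
each step goes from the vertex `u W_P` to the vertex with minimal length representative
`v`, where `v W_P = u s_α W_P` and `α ∈ R^+ \ R_P^+`. -/
inductive Chain (m kk : ℕ) :
    Equiv.Perm (Fin (2*m+2)) → Equiv.Perm (Fin (2*m+2)) → List PosRoot → Prop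
  | nil (u : Equiv.Perm (Fin (2*m+2))) : Chain m kk u u []
  | cons {u w : Equiv.Perm (Fin (2*m+2))} {l : List PosRoot}
      (a : PosRoot) (v : Equiv.Perm (Fin (2*m+2))) :
      a.valid m → a.rootCoeff m kk ≠ 0 → isMinRep m kk v →
      cosetEq m kk v (u * a.refl m) → Chain m kk v w l → Chain m kk u w (a :: l)

/-- The degree of a chain: the sum of the degrees of its edges. -/
def chainDeg (kk : ℕ) (l : List PosRoot) : ℕ := (l.map (PosRoot.corootCoeff kk)).sum

/-- Chains of a given total degree in the moment graph of `IG(kk, 2m+1)`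
(the full subgraph of the moment graph of `IG(kk, 2m+2)` on `W^P ∩ W^{odd}`). -/
inductive ChainO (m kk : ℕ) :
    Equiv.Perm (Fin (2*m+2)) → Equiv.Perm (Fin (2*m+2)) → ℕ → Prop
  | nil (u : Equiv.Perm (Fin (2*m+2))) : ChainO m kk u u 0
  | cons {u w : Equiv.Perm (Fin (2*m+2))} {d : ℕ}
      (a : PosRoot) (v : Equiv.Perm (Fin (2*m+2))) :
      a.valid m → a.rootCoeff m kk ≠ 0 → isMinRep m kk v → isOdd m v →
      cosetEq m kk v (u * a.refl m) → ChainO m kk v w d →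
      ChainO m kk u w (a.corootCoeff kk + d)

/-! ### The maps `Φ`, `Φ_Z`, `ψ` -/

/-- The relation `Φ(w W_P) = w' W_Y`, for `w` in the type `C_{n+1}` group and `w'` in the
type `C_n` group (entrywise shift of the first `kk` values). -/
def PhiRel (n kk : ℕ) (w : Equiv.Perm (Fin (2*n+2)))
    (w' : Equiv.Perm (Fin (2*(n-1)+2))) : Prop :=
  ∀ j, j < kk → ((w' (fn (n-1) j) : ℕ) + 1 = (w (fn n j) : ℕ))

/-- The relation `Φ_Z(w W_P) = w' W_Z` (entrywise shift of the values in positions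
`2, …, kk`). -/
def PhiZRel (n kk : ℕ) (w : Equiv.Perm (Fin (2*n+2)))
    (w' : Equiv.Perm (Fin (2*(n-1)+2))) : Prop :=
  ∀ j, j + 1 < kk → ((w' (fn (n-1) j) : ℕ) + 1 = (w (fn n (j+1)) : ℕ))

/-- The word `ψ(s_i)`. -/
def psiWord (kk i : ℕ) : List ℕ :=
  if i ≤ kk-1 then [i] else if i = kk then [kk, kk+1, kk] else [i+1]

/-- `j ↦ min({2,…,m+1} \ {|w(p)|, …, |w(kk)|})` (1-indexed positions `p ≤ j ≤ kk`). -/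
def jmin (m kk p : ℕ) (w : Equiv.Perm (Fin (2*m+2))) : ℕ :=
  sInf {i | 2 ≤ i ∧ i ≤ m+1 ∧ ∀ j, p ≤ j → j ≤ kk → absVal m (w (fn m (j-1))) ≠ i}

/-! ### Partitions -/

/-- `μ ∈ Part(k, N)`, encoded as a function `ℕ → ℤ` supported on `{1, …, k}`. -/
def IsPart (k N : ℕ) (μ : ℕ → ℤ) : Prop :=
  (∀ j, 1 ≤ j → j < k → μ (j+1) ≤ μ j) ∧ μ 1 ≤ (N:ℤ) - k ∧
  (∀ j, 1 ≤ j → j ≤ k → 0 ≤ μ j) ∧ (∀ j, j = 0 ∨ k < j → μ j = 0)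

/-- `D(μ)(i)`: the `i`-th step of the boundary path of the Young diagram of `μ` inside
the `k × (N-k)` rectangle (from northeast to southwest) is vertical. -/
def Dword (k N : ℕ) (μ : ℕ → ℤ) (i : ℕ) : Prop :=
  ∃ j, 1 ≤ j ∧ j ≤ k ∧ (i:ℤ) = (N:ℤ) - k - μ j + j

/-- `μ ∈ BC(k, 2n+2)`. -/
def IsBCeven (n k : ℕ) (μ : ℕ → ℤ) : Prop :=
  IsPart k (2*n+2) μ ∧
  ∀ i, 1 ≤ i → i ≤ n+1 → ¬(Dword k (2*n+2) μ i ∧ Dword k (2*n+2) μ (2*n+3-i))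

/-- `λ + 1^k`. -/
def addOne (k : ℕ) (lam : ℕ → ℤ) (j : ℕ) : ℤ := if 1 ≤ j ∧ j ≤ k then lam j + 1 else 0

/-- `λ ∈ BC(k, 2n+1)`: `λ ∈ Part(k, 2n+1)` and `λ + 1^k ∈ BC(k, 2n+2)`. -/
def IsBCodd (n k : ℕ) (lam : ℕ → ℤ) : Prop :=
  IsPart k (2*n+1) lam ∧ IsBCeven n k (addOne k lam)

/-- `β ∈ BKT(k, 2n+2)`: `(n+1-k)`-strict partitions. -/
def IsBKTeven (n k : ℕ) (β : ℕ → ℤ) : Prop :=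
  IsPart k (2*n+2) β ∧ ∀ j, 1 ≤ j → j < k → ((n:ℤ)+1-k < β j → β (j+1) < β j)

/-- `α ∈ BKT(k, 2n+1)`: `α = β - 1^k` with `β ∈ BKT(k, 2n+2)`. -/
def IsBKTodd (n k : ℕ) (α : ℕ → ℤ) : Prop :=
  IsBKTeven n k (addOne k α) ∧ (∀ j, j = 0 ∨ k < j → α j = 0)

/-- `ℓ(λ)`: the number of nonzero parts. -/
def numParts (k : ℕ) (lam : ℕ → ℤ) : ℕ :=
  ((Finset.Icc 1 k).filter (fun j => lam j ≠ 0)).card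

/-- `ℓ_i^d(λ) = #{j > d : λ_j > i}`. -/
def elld (k : ℕ) (lam : ℕ → ℤ) (i : ℤ) (d : ℕ) : ℕ :=
  ((Finset.Icc 1 k).filter (fun j => d < j ∧ i < lam j)).card

/-- `λ^{O∘(1)} = (λ_2-1, …, λ_{ℓ(λ)}-1, 0, …, 0)`. -/
def Oc1 (k : ℕ) (lam : ℕ → ℤ) (j : ℕ) : ℤ :=
  if 1 ≤ j ∧ j + 1 ≤ numParts k lam then lam (j+1) - 1 else 0

/-- `λ^{O∘(d)}`. -/
def OcD (k : ℕ) (lam : ℕ → ℤ) : ℕ → ℕ → ℤ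
  | 0 => lam
  | d+1 => Oc1 k (OcD k lam d)

/-- `λ^{O_Z(1)} = (λ_1, λ_3-1, …, λ_{ℓ(λ)}-1, 0, …, 0)` for `λ ∈ BC(k, 2n+1)`. -/
def OZ1 (k : ℕ) (lam : ℕ → ℤ) (j : ℕ) : ℤ :=
  if j = 1 then lam 1
  else if 2 ≤ j ∧ j + 1 ≤ numParts k lam then lam (j+1) - 1
  else 0

/-- `λ^{O_Z(d)}`. -/
def OZd (k : ℕ) (lam : ℕ → ℤ) : ℕ → ℕ → ℤ
  | 0 => lam
  | d+1 => OZ1 k (OZd k lam d)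

/-- `Comp_BC(d)`. -/
def CompBC (n k d : ℕ) (lam : ℕ → ℤ) : Prop :=
  IsBCodd n k lam ∧ lam 1 = 2*(n:ℤ)+1-k ∧
  lam (d+1) - (elld k lam ((d:ℤ)-1) (d+1) : ℤ) - d = 2*((n:ℤ)+1-k)

/-- The transposed partition. -/
def transpose (k : ℕ) (μ : ℕ → ℤ) (j : ℕ) : ℤ :=
  if 1 ≤ j then (((Finset.Icc 1 k).filter (fun i => (j:ℤ) ≤ μ i)).card : ℤ) else 0

/-- `D(μ)(i) = D(μ^t)(i)`. -/
def wingAgree (n k : ℕ) (μ : ℕ → ℤ) (i : ℕ) : Prop :=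
  Dword k (2*n+2) μ i ↔ Dword (2*n+2-k) (2*n+2) (transpose k μ) i

/-- `μ ∈ Part(k, 2n+2)` is `m`-wingtip symmetric. -/
def isWingtipEven (n k : ℕ) (μ : ℕ → ℤ) (m : ℕ) : Prop :=
  (∀ i, 1 ≤ i → i ≤ m → wingAgree n k μ i) ∧ (m = 2*n+2 ∨ ¬ wingAgree n k μ (m+1))

/-- `λ ∈ BC(k, 2n+1)` is `m`-wingtip symmetric. -/
def isWingtip (n k : ℕ) (lam : ℕ → ℤ) (m : ℕ) : Prop :=
  isWingtipEven n k (addOne k lam) m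

open scoped Classical in
/-- `λ^{O_Y(1)}` for an `m`-wingtip symmetric `λ ∈ BC(k, 2n+1)` with `λ_1 = 2n+1-k`. -/
def OY1 (n k m : ℕ) (lam : ℕ → ℤ) : ℕ → ℤ :=
  -- the step of `D(λ)` at position `bar m = 2n+3-m`
  let s := 2*n+3-m
  -- the row at (or just above) the step at position `s`
  let i := ((Finset.Icc 1 s).filter (fun t => Dword k (2*n+2) (addOne k lam) t)).card
  -- the column of the step at position `s` (when horizontal)
  let j := (2*n+2-k) + 1 -
    ((Finset.Icc 1 s).filter (fun t => ¬ Dword k (2*n+2) (addOne k lam) t)).card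
  if Dword k (2*n+2) (addOne k lam) s then
    -- `D(λ)(bar m) = 1` is the `i`-th 1: `(λ_2-1, …, λ_{i-1}-1, λ_i, λ_i, λ_{i+1}, …, λ_k)`
    fun p =>
      if 1 ≤ p ∧ p + 2 ≤ i then lam (p+1) - 1
      else if (p = i - 1 ∨ p = i) ∧ 1 ≤ p ∧ p ≤ k then lam i
      else if i + 1 ≤ p ∧ p ≤ k then lam p
      else 0
  else
    -- horizontal step at the bottom of row `i`, column `j`:
    -- `(λ_2-1, …, λ_i-1, j, λ_{i+1}, …, λ_k)`
    fun p =>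
      if 1 ≤ p ∧ p + 1 ≤ i then lam (p+1) - 1
      else if p = i ∧ 1 ≤ p ∧ p ≤ k then (j:ℤ)
      else if i + 1 ≤ p ∧ p ≤ k then lam p
      else 0

/-- `λ^{O_Y(d)} = (λ^{O_Y(1)})^{O∘(d-1)}`. -/
def OYd (n k m : ℕ) (lam : ℕ → ℤ) (d : ℕ) : ℕ → ℤ := OcD k (OY1 n k m lam) (d-1)

open scoped Classical in
/-- `α^{O_Z(1)}` for `α ∈ BKT(k, 2n+1)` with `α_1 = 2n+1-k`. -/
def OZ1bkt (n k : ℕ) (α : ℕ → ℤ) : ℕ → ℤ :=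
  if ∃ j, 3 ≤ j ∧ j ≤ k ∧ α 2 + α j ≤ 2*((n:ℤ)-k)+j-2 then
    -- `j0` minimal such that `α_2 + α_{j0} ≤ 2(n-k)+j0-2`
    let j0 := sInf {j | 3 ≤ j ∧ j ≤ k ∧ α 2 + α j ≤ 2*((n:ℤ)-k)+j-2}
    fun p =>
      if p = 1 then α 1
      else if 2 ≤ p ∧ p + 2 ≤ j0 then α (p+1)
      else if j0 ≤ p + 1 ∧ p + 1 ≤ k then max (α (p+1) - 1) (-1)
      else if p = k then -1 else 0
  else
    fun p =>
      if p = 1 then α 1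
      else if 2 ≤ p ∧ p + 1 ≤ k then α (p+1)
      else if p = k then -1 else 0

/-- `α^{O_Z(d)}`. -/
def OZdbkt (n k : ℕ) (α : ℕ → ℤ) : ℕ → ℕ → ℤ
  | 0 => α
  | d+1 => OZ1bkt n k (OZdbkt n k α d)

/-- `Comp_BKT(d)`. -/
def CompBKT (n k d : ℕ) (α : ℕ → ℤ) : Prop :=
  IsBKTodd n k α ∧ α 1 = 2*(n:ℤ)+1-k ∧
  (OZdbkt n k α (d-1)) 2 - (elld k (OZdbkt n k α (d-1)) (-1) 2 : ℤ) = 2*((n:ℤ)+1-k)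

/-- `ℓ_{-1}(α) = max {j : α_j > -1}`. -/
def ellNeg (k : ℕ) (α : ℕ → ℤ) : ℕ :=
  ((Finset.Icc 1 k).filter (fun j => (-1:ℤ) < α j)).sup id

/-- `α^{O_Y(1)} = (α_2, …, α_{ℓ_{-1}(α)}, 0, …, 0)` for `α ∈ BKT(k, 2n+1)` with
`α_1 = 2n+1-k`. -/
def OY1bkt (k : ℕ) (α : ℕ → ℤ) (j : ℕ) : ℤ :=
  if 1 ≤ j ∧ j + 1 ≤ ellNeg k α then α (j+1) else 0

/-! ### Correspondences between partitions and Weyl group elements -/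

/-- The 01-word correspondence between `μ ∈ BC(k, 2n+2)` and `w ∈ W^P`: for a 1-indexed
value `a ∈ {1, …, n+1}`, `a` occurs among the first `k` values of `w` iff `D(μ)(a) = 1`,
and `bar a` occurs iff `D(μ)(2n+3-a) = 1`. -/
def BCrel (n k : ℕ) (μ : ℕ → ℤ) (w : Equiv.Perm (Fin (2*n+2))) : Prop :=
  ∀ i, 1 ≤ i → i ≤ n+1 →
    ((fn n (i-1) ∈ valSet n k w) ↔ Dword k (2*n+2) μ i) ∧
    ((fn n (2*n+2-i) ∈ valSet n k w) ↔ Dword k (2*n+2) μ (2*n+3-i))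

/-- The BKT correspondence between `β ∈ BKT(k, 2n+2)` and `w ∈ W^P`:
`β_j = 2n+3-k-w(j) + #{i < j : w(i)+w(j) > 2n+3}` (1-indexed values). -/
def BKTrel (n k : ℕ) (β : ℕ → ℤ) (w : Equiv.Perm (Fin (2*n+2))) : Prop :=
  ∀ j, 1 ≤ j → j ≤ k →
    β j = 2*(n:ℤ)+3-k - ((w (fn n (j-1)) : ℕ) + 1) +
      (((Finset.Icc 1 (j-1)).filter
        (fun i => 2*n+1 < (w (fn n (i-1)) : ℕ) + (w (fn n (j-1)) : ℕ))).card : ℤ)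


@[simp] lemma fn_val {m i : ℕ} (h : i < 2*m+2) : ((fn m i : Fin (2*m+2)) : ℕ) = i := by
  simp [fn, Nat.mod_eq_of_lt h]

@[simp] lemma bar_val (m : ℕ) (x : Fin (2*m+2)) : (bar m x : ℕ) = 2*m+1 - x := rfl

@[simp] lemma bar_bar (m : ℕ) (x : Fin (2*m+2)) : bar m (bar m x) = x := by
  have := x.isLt
  apply Fin.ext
  simp
  omega

lemma mem_Weyl_iff {m : ℕ} {u : Equiv.Perm (Fin (2*m+2))} :
    u ∈ Weyl m ↔ ∀ x, u (bar m x) = bar m (u x) := by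
  rw [Weyl, Subgroup.mem_centralizer_singleton_iff, Equiv.ext_iff]
  rfl

/-- The reflection of the group of signed permutations exchanging `p` and `q`. -/
def signedSwap (m : ℕ) (p q : Fin (2*m+2)) : Equiv.Perm (Fin (2*m+2)) :=
  if q = bar m p then Equiv.swap p q else Equiv.swap p q * Equiv.swap (bar m p) (bar m q)

lemma conj_signedSwap {m : ℕ} {u : Equiv.Perm (Fin (2*m+2))} (hu : u ∈ Weyl m)
    (p q : Fin (2*m+2)) : u * signedSwap m p q * u⁻¹ = signedSwap m (u p) (u q) := by
  rw [mem_Weyl_iff] at hu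
  unfold signedSwap
  simp only [← hu, u.injective.eq_iff]
  split_ifs
  · rw [Equiv.swap_apply_apply]
  · rw [Equiv.swap_apply_apply, Equiv.swap_apply_apply]
    group

lemma val_signedSwap {m : ℕ} {p q : Fin (2*m+2)} (hpq : p ≠ q) (x : Fin (2*m+2)) :
    (signedSwap m p q x : ℕ) = if x = p then (q : ℕ) else if x = q then (p : ℕ)
      else if (x : ℕ) = 2*m+1-p then 2*m+1-q else if (x : ℕ) = 2*m+1-q then 2*m+1-p else x := by
  have := x.isLt
  have := p.isLt
  have := q.isLt
  simp only [signedSwap, Fin.ext_iff, bar_val, ne_eq] at *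
  split_ifs <;> simp only [Equiv.Perm.mul_apply, Equiv.swap_apply_def, Fin.ext_iff, bar_val] <;>
    split_ifs <;> simp_all <;> omega

lemma signedSwap_mul_self (m : ℕ) (p q : Fin (2*m+2)) :
    signedSwap m p q * signedSwap m p q = 1 := by
  rcases eq_or_ne p q with rfl | hpq
  · simp only [signedSwap, Equiv.swap_self]
    split_ifs <;> rfl
  ext x
  have := x.isLt
  have := p.isLt
  have := q.isLt
  rw [Equiv.Perm.mul_apply, val_signedSwap hpq]
  simp only [Fin.ext_iff, val_signedSwap hpq, Equiv.Perm.one_apply, ne_eq] at *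
  split_ifs <;> omega

lemma sRefl_eq_signedSwap {m i : ℕ} (hi : 1 ≤ i) (hi' : i ≤ m+1) :
    sRefl m i = signedSwap m (fn m (i-1)) (fn m i) := by
  have hb : bar m (fn m (i-1)) = fn m (2*m+2-i) := by
    apply Fin.ext
    rw [bar_val, fn_val (by omega), fn_val (by omega)]
    omega
  have hb' : bar m (fn m i) = fn m (2*m+1-i) := by
    apply Fin.ext
    rw [bar_val, fn_val (by omega), fn_val (by omega)]
  have hc : fn m i = fn m (2*m+2-i) ↔ i = m+1 := by
    rw [Fin.ext_iff, fn_val (by omega), fn_val (by omega)]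
    omega
  unfold sRefl signedSwap
  simp only [hb, hb', hc]
  split_ifs
  · omega
  · rfl
  · subst i
    rfl
  · omega

lemma val_sRefl {m i : ℕ} (hi : 1 ≤ i) (hi' : i ≤ m+1) (x : Fin (2*m+2)) :
    (sRefl m i x : ℕ) = if (x : ℕ) = i-1 then i else if (x : ℕ) = i then i-1
      else if (x : ℕ) = 2*m+2-i then 2*m+1-i else if (x : ℕ) = 2*m+1-i then 2*m+2-i else x := by
  have hne : fn m (i-1) ≠ fn m i := by
    rw [Ne, Fin.ext_iff, fn_val (by omega), fn_val (by omega)]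
    omega
  rw [sRefl_eq_signedSwap hi hi', val_signedSwap hne]
  simp only [Fin.ext_iff]
  rw [fn_val (by omega), fn_val (by omega)]
  split_ifs <;> omega

lemma sRefl_mem_Weyl {m i : ℕ} (hi : 1 ≤ i) (hi' : i ≤ m+1) : sRefl m i ∈ Weyl m := by
  rw [mem_Weyl_iff]
  intro x
  have := x.isLt
  apply Fin.ext
  rw [bar_val, val_sRefl hi hi', val_sRefl hi hi', bar_val]
  split_ifs <;> omega

lemma sRefl_mul_self {m i : ℕ} (hi : 1 ≤ i) (hi' : i ≤ m+1) : sRefl m i * sRefl m i = 1 := by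
  rw [sRefl_eq_signedSwap hi hi', signedSwap_mul_self]

/-- A simple reflection inverts only the pairs which it exchanges. -/
lemma signedSwap_eq_sRefl {m i : ℕ} (hi : 1 ≤ i) (hi' : i ≤ m+1) {x y : Fin (2*m+2)}
    (hxy : x < y) (h : sRefl m i y < sRefl m i x) : signedSwap m x y = sRefl m i := by
  ext z
  have := x.isLt
  have := y.isLt
  have := z.isLt
  rw [Fin.lt_def] at hxy h
  rw [val_sRefl hi hi', val_sRefl hi hi'] at h
  have hxy' : ((x : ℕ) = i-1 ∧ (y : ℕ) = i) ∨ ((x : ℕ) = 2*m+1-i ∧ (y : ℕ) = 2*m+2-i) := by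
    split_ifs at h <;> omega
  rw [val_signedSwap (by rintro rfl; omega), val_sRefl hi hi']
  simp only [Fin.ext_iff]
  obtain ⟨hx, hy⟩ | ⟨hx, hy⟩ := hxy' <;> rw [hx, hy] <;> split_ifs <;> omega

/-- The words in the simple reflections. -/
def IsWord (m : ℕ) (l : List ℕ) : Prop := ∀ i ∈ l, 1 ≤ i ∧ i ≤ m+1

lemma word_prod_mem_Weyl {m : ℕ} {l : List ℕ} (hl : IsWord m l) :
    (l.map (sRefl m)).prod ∈ Weyl m := by
  refine Subgroup.list_prod_mem _ fun x hx => ?_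
  obtain ⟨i, hi, rfl⟩ := List.mem_map.1 hx
  exact sRefl_mem_Weyl (hl i hi).1 (hl i hi).2

/-- The exchange condition. -/
lemma exists_shorter_word {m : ℕ} {p q : Fin (2*m+2)} (hpq : p < q) (l : List ℕ)
    (hl : IsWord m l) (h : (l.map (sRefl m)).prod q < (l.map (sRefl m)).prod p) :
    ∃ l', IsWord m l' ∧ l'.length < l.length ∧
      (l'.map (sRefl m)).prod = (l.map (sRefl m)).prod * signedSwap m p q := by
  induction l with
  | nil =>
    simp only [List.map_nil, List.prod_nil, Equiv.Perm.one_apply] at h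
    exact absurd h hpq.not_gt
  | cons i l ih =>
    obtain ⟨hi, hl'⟩ := List.forall_mem_cons.1 hl
    have hu := word_prod_mem_Weyl hl'
    simp only [List.map_cons, List.prod_cons] at h ⊢
    set u := (l.map (sRefl m)).prod
    rcases lt_trichotomy (u p) (u q) with hlt | heq | hgt
    · refine ⟨l, hl', by simp, ?_⟩
      have hs : u * signedSwap m p q * u⁻¹ = sRefl m i := by
        rw [conj_signedSwap hu]
        exact signedSwap_eq_sRefl hi.1 hi.2 hlt h
      rw [mul_inv_eq_iff_eq_mul] at hs
      rw [mul_assoc, hs, ← mul_assoc, sRefl_mul_self hi.1 hi.2, one_mul]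
    · exact absurd (u.injective heq) hpq.ne
    · obtain ⟨l', hw, hlen, hprod⟩ := ih hl' hgt
      exact ⟨i :: l', List.forall_mem_cons.2 ⟨hi, hw⟩, by simpa using hlen,
        by rw [List.map_cons, List.prod_cons, hprod, mul_assoc]⟩

lemma eq_one_of_no_descent {m : ℕ} {u : Equiv.Perm (Fin (2*m+2))} (hu : u ∈ Weyl m)
    (h : ∀ i, 1 ≤ i → i ≤ m+1 → u (fn m (i-1)) ≤ u (fn m i)) : u = 1 := by
  rw [mem_Weyl_iff] at hu
  have hmono : Monotone u := by
    refine Fin.monotone_iff_le_succ.2 fun (x : Fin (2*m+1)) => ?_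
    have hx := x.isLt
    rcases le_or_gt (x : ℕ) m with hxm | hxm
    · have h1 := h (x+1) (by omega) (by omega)
      have e1 : fn m (x+1-1) = x.castSucc := by
        apply Fin.ext
        rw [fn_val (by omega), Fin.val_castSucc, Nat.add_sub_cancel]
      have e2 : fn m (x+1) = x.succ := by
        apply Fin.ext
        rw [fn_val (by omega), Fin.val_succ]
      rwa [e1, e2] at h1
    · have h1 := h (2*m+1-x) (by omega) (by omega)
      have e1 : fn m (2*m+1-x-1) = bar m x.succ := by
        apply Fin.ext
        rw [fn_val (by omega), bar_val, Fin.val_succ]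
        omega
      have e2 : fn m (2*m+1-x) = bar m x.castSucc := by
        apply Fin.ext
        rw [fn_val (by omega), bar_val, Fin.val_castSucc]
      rw [e1, e2, hu, hu, Fin.le_def, bar_val, bar_val] at h1
      have := (u x.succ).isLt
      have := (u x.castSucc).isLt
      rw [Fin.le_def]
      omega
  have hs : StrictMono u := hmono.strictMono_of_injective u.injective
  have := (StrictMono.range_inj hs strictMono_id).1 (by simp [u.surjective.range_eq])
  exact Equiv.ext fun x => congrFun this x

/-- The simple reflections generate the Weyl group. -/
lemma exists_word {m : ℕ} (u : Equiv.Perm (Fin (2*m+2))) (hu : u ∈ Weyl m) :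
    ∃ l, IsWord m l ∧ (l.map (sRefl m)).prod = u := by
  induction hf : toLex (⇑u) using WellFoundedLT.induction generalizing u with
  | ind f ih =>
    subst hf
    by_cases hd : ∀ i, 1 ≤ i → i ≤ m+1 → u (fn m (i-1)) ≤ u (fn m i)
    · exact ⟨[], by simp [IsWord], by simp [eq_one_of_no_descent hu hd]⟩
    · push Not at hd
      obtain ⟨i, hi, hi', hlt⟩ := hd
      have hlex : toLex (⇑(u * sRefl m i)) < toLex (⇑u) := by
        refine ⟨fn m (i-1), fun x hx => ?_, ?_⟩
        · have : sRefl m i x = x := by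
            apply Fin.ext
            have hx' : (x : ℕ) < fn m (i-1) := hx
            rw [fn_val (by omega)] at hx'
            rw [val_sRefl hi hi']
            split_ifs <;> omega
          change u (sRefl m i x) = u x
          rw [this]
        · have : sRefl m i (fn m (i-1)) = fn m i := by
            apply Fin.ext
            rw [val_sRefl hi hi', fn_val (by omega), fn_val (by omega), if_pos rfl]
          change u (sRefl m i _) < u _
          rwa [this]
      obtain ⟨l, hl, hprod⟩ := ih _ hlex _ (mul_mem hu (sRefl_mem_Weyl hi hi')) rfl
      refine ⟨l ++ [i], ?_, ?_⟩
      · simpa [IsWord, or_imp, forall_and, hi, hi'] using hl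
      · simp [hprod, mul_assoc, sRefl_mul_self hi hi']

/-- Multiplying by the reflection in an inversion decreases the length. -/
lemma len_mul_signedSwap_lt {m : ℕ} {u : Equiv.Perm (Fin (2*m+2))} (hu : u ∈ Weyl m)
    {p q : Fin (2*m+2)} (hpq : p < q) (h : u q < u p) :
    len m (u * signedSwap m p q) < len m u := by
  obtain ⟨l₀, hl₀, hprod₀⟩ := exists_word u hu
  obtain ⟨l, hlen, hl, rfl⟩ := Nat.sInf_mem (s := {r | ∃ l : List ℕ, l.length = r ∧
    (∀ i ∈ l, 1 ≤ i ∧ i ≤ m+1) ∧ (l.map (sRefl m)).prod = u}) ⟨_, l₀, rfl, hl₀, hprod₀⟩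
  obtain ⟨l', hl', hlt, hprod⟩ := exists_shorter_word hpq l hl h
  calc len m ((l.map (sRefl m)).prod * signedSwap m p q) ≤ l'.length :=
        Nat.sInf_le ⟨l', rfl, hl', hprod⟩
    _ < l.length := hlt
    _ = len m (l.map (sRefl m)).prod := hlen

lemma WP_le_Weyl (m k : ℕ) : WP m k ≤ Weyl m := by
  rw [WP, Subgroup.closure_le]
  rintro _ ⟨i, hi, hi', -, rfl⟩
  exact sRefl_mem_Weyl hi hi'

lemma WP_apply_lt {m k : ℕ} (hk' : k ≤ m+1) {u : Equiv.Perm (Fin (2*m+2))} (hu : u ∈ WP m k)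
    {x : Fin (2*m+2)} (hx : (x : ℕ) < k) : (u x : ℕ) < k := by
  have hs : ∀ i, 1 ≤ i → i ≤ m+1 → i ≠ k →
      ∀ x : Fin (2*m+2), (x : ℕ) < k → (sRefl m i x : ℕ) < k := by
    intro i hi hi' hik x hx
    rw [val_sRefl hi hi']
    split_ifs <;> omega
  induction hu using Subgroup.closure_induction'' generalizing x with
  | mem _ h =>
    obtain ⟨i, hi, hi', hik, rfl⟩ := h
    exact hs i hi hi' hik x hx
  | inv_mem _ h =>
    obtain ⟨i, hi, hi', hik, rfl⟩ := h
    rw [inv_eq_of_mul_eq_one_left (sRefl_mul_self hi hi')]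
    exact hs i hi hi' hik x hx
  | one => exact hx
  | mul _ _ _ _ h₁ h₂ => exact h₁ (h₂ hx)

lemma isMinRep.eq_zero_of_apply_eq_zero {m k : ℕ} (hk' : k ≤ m+1)
    {v : Equiv.Perm (Fin (2*m+2))} (hv : isMinRep m k v) {x : Fin (2*m+2)} (hx : (x : ℕ) < k)
    (h : v x = fn m 0) : x = fn m 0 := by
  by_contra hne
  have hx0 : 1 ≤ (x : ℕ) := by
    rw [Fin.ext_iff, fn_val (by omega)] at hne
    omega
  have hxx : fn m x = x := Fin.ext (fn_val x.isLt)
  have hlt : fn m (x-1) < fn m x := by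
    rw [Fin.lt_def, fn_val (by omega), fn_val (by omega)]
    omega
  have hdesc : v (fn m x) < v (fn m (x-1)) := by
    have : v (fn m (x-1)) ≠ v (fn m x) := v.injective.ne hlt.ne
    rw [hxx, h, Ne, Fin.ext_iff, fn_val (by omega)] at this
    rw [hxx, h, Fin.lt_def, fn_val (by omega)]
    omega
  have hlen := len_mul_signedSwap_lt hv.1 hlt hdesc
  rw [← sRefl_eq_signedSwap hx0 (by omega)] at hlen
  exact hlen.not_ge
    (hv.2 _ (Subgroup.subset_closure ⟨x, hx0, by omega, by omega, rfl⟩))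

lemma refl_tm_eq_signedSwap {m i j : ℕ} (h : (PosRoot.tm i j).valid m) :
    (PosRoot.tm i j).refl m = signedSwap m (fn m (i-1)) (fn m (j-1)) := by
  obtain ⟨hi, hij, hj⟩ := h
  have hb : ∀ a, 1 ≤ a → a ≤ m+1 → bar m (fn m (a-1)) = fn m (2*m+2-a) := by
    intro a ha ha'
    apply Fin.ext
    rw [bar_val, fn_val (by omega), fn_val (by omega)]
    omega
  rw [signedSwap, if_neg, hb i hi (by omega), hb j (by omega) hj, PosRoot.refl]
  rw [hb i hi (by omega), Fin.ext_iff, fn_val (by omega), fn_val (by omega)]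
  omega

lemma refl_tp_eq_signedSwap {m i j : ℕ} (h : (PosRoot.tp i j).valid m) :
    (PosRoot.tp i j).refl m = signedSwap m (fn m (i-1)) (fn m (2*m+2-j)) := by
  obtain ⟨hi, hij, hj⟩ := h
  have hb : ∀ a, 1 ≤ a → a ≤ m+1 → bar m (fn m (a-1)) = fn m (2*m+2-a) := by
    intro a ha ha'
    apply Fin.ext
    rw [bar_val, fn_val (by omega), fn_val (by omega)]
    omega
  have hb' : bar m (fn m (2*m+2-j)) = fn m (j-1) := by
    rw [← hb j (by omega) hj, bar_bar]
  rw [signedSwap, if_neg, hb i hi (by omega), hb', PosRoot.refl, Equiv.swap_comm (fn m (j-1))]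
  rw [hb i hi (by omega), Fin.ext_iff, fn_val (by omega), fn_val (by omega)]
  omega

lemma refl_lg_eq_signedSwap {m i : ℕ} (h : (PosRoot.lg i).valid m) :
    (PosRoot.lg i).refl m = signedSwap m (fn m (i-1)) (fn m (2*m+2-i)) := by
  obtain ⟨hi, hi'⟩ := h
  rw [signedSwap, if_pos, PosRoot.refl]
  apply Fin.ext
  rw [bar_val, fn_val (by omega), fn_val (by omega)]
  omega

/-- A positive root is either `t_1 ± t_j` with `j > k`, or its reflection sends one of the first
`k` positions to the first or to the last one. -/
lemma PosRoot.eq_or_refl_apply {m k : ℕ} (hk : 1 ≤ k) (hk' : k ≤ m+1) {a : PosRoot}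
    (ha : a.valid m) :
    (∃ j, k+1 ≤ j ∧ j ≤ m+1 ∧ (a = PosRoot.tm 1 j ∨ a = PosRoot.tp 1 j)) ∨
      ∃ x : Fin (2*m+2), (x : ℕ) < k ∧
        (a.refl m x = fn m 0 ∨ a.refl m x = fn m (2*m+1)) := by
  have key : ∀ p q : ℕ, p < q → q < 2*m+2 → (p = 0 → q < k ∨ 2*m+1-k < q) →
      (p ≠ 0 → q ≠ 2*m+1) → ∃ x : Fin (2*m+2), (x : ℕ) < k ∧
        (signedSwap m (fn m p) (fn m q) x = fn m 0 ∨
          signedSwap m (fn m p) (fn m q) x = fn m (2*m+1)) := by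
    intro p q hpq hq h0 h1
    have hne : fn m p ≠ fn m q := by
      rw [Ne, Fin.ext_iff, fn_val (by omega), fn_val (by omega)]
      omega
    simp only [Fin.ext_iff, val_signedSwap hne]
    rw [fn_val (by omega), fn_val hq, fn_val (by omega), fn_val (by omega)]
    by_cases hp : p = 0
    · rcases h0 hp with hqk | hqk
      · refine ⟨fn m q, ?_⟩
        rw [fn_val hq]
        split_ifs <;> omega
      · refine ⟨fn m (2*m+1-q), ?_⟩
        rw [fn_val (by omega)]
        split_ifs <;> omega
    · refine ⟨fn m 0, ?_⟩
      have := h1 hp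
      rw [fn_val (by omega)]
      split_ifs <;> omega
  rw [or_iff_not_imp_left]
  intro hn
  cases a with
  | tm i j =>
    rw [refl_tm_eq_signedSwap ha]
    obtain ⟨hi, hij, hj⟩ := ha
    refine key _ _ (by omega) (by omega) (fun h => ?_) (by omega)
    by_contra hc
    exact hn ⟨j, by omega, hj, Or.inl (by rw [show i = 1 by omega])⟩
  | tp i j =>
    rw [refl_tp_eq_signedSwap ha]
    obtain ⟨hi, hij, hj⟩ := ha
    refine key _ _ (by omega) (by omega) (fun h => ?_) (by omega)
    by_contra hc
    exact hn ⟨j, by omega, hj, Or.inr (by rw [show i = 1 by omega])⟩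
  | lg i =>
    rw [refl_lg_eq_signedSwap ha]
    obtain ⟨hi, hi'⟩ := ha
    exact key _ _ (by omega) (by omega) (by omega) (by omega)

/-- An edge of the moment graph joining a vertex `w` in the closed
orbit (`w(1) = 1`) to a vertex `v` meeting the open orbit (`v(1) ≠ 1`) is labelled by
a root `α = t_1 ± t_j` with `k+1 ≤ j ≤ n+1`, has degree 1, and `ℓ(v) > ℓ(w)`. -/
theorem statement11 (n k : ℕ) (hn : 1 ≤ n) (hk : 1 ≤ k) (hk' : k ≤ n+1)
    (w v : Equiv.Perm (Fin (2*n+2)))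
    (hw : isMinRep n k w) (hwodd : isOdd n w) (hw1 : w (fn n 0) = fn n 0)
    (hv : isMinRep n k v) (hvodd : isOdd n v) (hv1 : v (fn n 0) ≠ fn n 0)
    (a : PosRoot) (ha : a.valid n) (haP : a.rootCoeff n k ≠ 0)
    (hcoset : cosetEq n k v (w * a.refl n)) :
    ((∃ j, k+1 ≤ j ∧ j ≤ n+1 ∧ (a = PosRoot.tm 1 j ∨ a = PosRoot.tp 1 j)) ∧
      a.corootCoeff k = 1) ∧
    len n w < len n v := by
  obtain ⟨u, hu⟩ : ∃ u, u = v⁻¹ * (w * a.refl n) := ⟨_, rfl⟩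
  have huP : u ∈ WP n k := hu ▸ hcoset
  have hvu : v * u = w * a.refl n := by rw [hu, mul_inv_cancel_left]
  have happ : ∀ x, v (u x) = w (a.refl n x) := fun x => Equiv.ext_iff.1 hvu x
  have hw1' : w (fn n (2*n+1)) = fn n (2*n+1) := by
    have hb : fn n (2*n+1) = bar n (fn n 0) := by
      apply Fin.ext
      rw [bar_val, fn_val (by omega), fn_val (by omega)]
      rfl
    rw [hb, mem_Weyl_iff.1 hw.1, hw1]
  have hroot : ∃ j, k+1 ≤ j ∧ j ≤ n+1 ∧ (a = PosRoot.tm 1 j ∨ a = PosRoot.tp 1 j) := by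
    refine (PosRoot.eq_or_refl_apply hk hk' ha).resolve_right ?_
    rintro ⟨x, hx, h0 | h0⟩
    · have hux : v (u x) = fn n 0 := by rw [happ, h0, hw1]
      rw [hv.eq_zero_of_apply_eq_zero hk' (WP_apply_lt hk' huP hx) hux] at hux
      exact hv1 hux
    · have := WP_apply_lt hk' huP hx
      exact hvodd (u x) (by omega) (by rw [happ, h0, hw1'])
  refine ⟨⟨hroot, ?_⟩, ?_⟩
  · obtain ⟨j, hj, -, rfl | rfl⟩ := hroot <;>
      exact if_pos ⟨hk, by omega⟩
  obtain ⟨q, hq, hrefl⟩ : ∃ q : Fin (2*n+2), k ≤ q ∧ a.refl n = signedSwap n (fn n 0) q := by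
    obtain ⟨j, hj, hjn, rfl | rfl⟩ := hroot
    · exact ⟨fn n (j-1), by rw [fn_val (by omega)]; omega, refl_tm_eq_signedSwap ha⟩
    · exact ⟨fn n (2*n+2-j), by rw [fn_val (by omega)]; omega, refl_tp_eq_signedSwap ha⟩
  have hq0 : fn n 0 ≠ q := by
    rw [Ne, Fin.ext_iff, fn_val (by omega)]
    omega
  have hp : (u (fn n 0) : ℕ) < k := WP_apply_lt hk' huP (by rwa [fn_val (by omega)])
  have huq : k ≤ (u q : ℕ) := by
    by_contra! hlt
    have := WP_apply_lt hk' (inv_mem huP) hlt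
    rw [Equiv.Perm.inv_def, Equiv.symm_apply_apply] at this
    omega
  have hvp : v (u (fn n 0)) = w q := by
    rw [happ, hrefl]
    congr 1
    apply Fin.ext
    rw [val_signedSwap hq0, if_pos rfl]
  have hvq : v (u q) = fn n 0 := by
    have : signedSwap n (fn n 0) q q = fn n 0 := by
      apply Fin.ext
      rw [val_signedSwap hq0, if_neg hq0.symm, if_pos rfl]
    rw [happ, hrefl, this, hw1]
  have hinv : v (u q) < v (u (fn n 0)) := by
    have := w.injective.ne hq0
    rw [hw1, Ne, Fin.ext_iff, fn_val (by omega)] at this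
    rw [hvp, hvq, Fin.lt_def, fn_val (by omega)]
    omega
  have hinvol : a.refl n * a.refl n = 1 := by
    rw [hrefl, signedSwap_mul_self]
  have hmul : v * signedSwap n (u (fn n 0)) (u q) = w * u⁻¹ := by
    rw [← conj_signedSwap (WP_le_Weyl n k huP), ← hrefl, ← mul_assoc, ← mul_assoc, hvu,
      mul_assoc w, hinvol, mul_one]
  calc len n w ≤ len n (w * u⁻¹) := hw.2 _ (inv_mem huP)
    _ = len n (v * signedSwap n (u (fn n 0)) (u q)) := by rw [hmul]
    _ < len n v := len_mul_signedSwap_lt hv.1 (Fin.lt_def.2 (by omega)) hinv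

end
end OddSymplectic
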